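/- arXiv:1709.10219 — 7 statements merged into one kernel-verified Lean document; each statement's English description precedes it below -/
import Mathlib

section
/- (Theorem 1) Let λ > 0, let M ∈ ℝ^{n×n} have nonnegative entries, and let p, q ∈ S_{n-1}. Then the function L_λ(P) = (1/(1+λ))⟨M,P⟩ - (λ/(1+λ))H(P) attains its minimum over U(p,q) at a plan P* that is entrywise strictly positive, and there exist strictly positive vectors a, b ∈ ℝ^n and a constant c > 0 such that P*_ij = c · a_i · b_j · exp(-m_ij/λ) for all i, j, with c = 1 / (Σ_{ij} a_i b_j exp(-m_ij/λ)). -/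
open Finset Real

/-- Membership in the probability simplex `S_{n-1}`: strictly positive entries summing to 1. -/
def IsSimplex {n : ℕ} (p : Fin n → ℝ) : Prop :=
  (∀ i, 0 < p i) ∧ ∑ i, p i = 1

/-- `P ∈ U(p,q)`: a transportation plan with marginals `p` (rows) and `q` (columns). -/
def IsPlan {n : ℕ} (p q : Fin n → ℝ) (P : Matrix (Fin n) (Fin n) ℝ) : Prop :=
  (∀ i j, 0 ≤ P i j) ∧ (∀ i, ∑ j, P i j = p i) ∧ (∀ j, ∑ i, P i j = q j)

/-- Entropy of a plan, `H(P) = -Σ P_ij log P_ij` (with `0 log 0 = 0`). -/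
noncomputable def entM {n : ℕ} (P : Matrix (Fin n) (Fin n) ℝ) : ℝ :=
  -∑ i, ∑ j, P i j * Real.log (P i j)

/-- Entropy of a probability vector. -/
noncomputable def entV {n : ℕ} (p : Fin n → ℝ) : ℝ :=
  -∑ i, p i * Real.log (p i)

/-- Transportation cost `⟨M, P⟩ = Σ m_ij P_ij`. -/
noncomputable def cost {n : ℕ} (M P : Matrix (Fin n) (Fin n) ℝ) : ℝ :=
  ∑ i, ∑ j, M i j * P i j

/-- KL-divergence between two matrices (finite-valued formula, `0 log 0 = 0`). -/
noncomputable def klM {n : ℕ} (P Q : Matrix (Fin n) (Fin n) ℝ) : ℝ :=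
  ∑ i, ∑ j, P i j * Real.log (P i j / Q i j)

/-- The entropy-relaxed transportation objective
`L_λ(P) = (1/(1+λ))⟨M,P⟩ - (λ/(1+λ)) H(P)`. -/
noncomputable def Lfun {n : ℕ} (lam : ℝ) (M P : Matrix (Fin n) (Fin n) ℝ) : ℝ :=
  (1 / (1 + lam)) * cost M P - (lam / (1 + lam)) * entM P

/-- The Cuturi function `C_λ(p,q) = min_{P ∈ U(p,q)} L_λ(P)` (as an infimum, which is
attained on the compact set `U(p,q)`). -/
noncomputable def Cfun {n : ℕ} (lam : ℝ) (M : Matrix (Fin n) (Fin n) ℝ)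
    (p q : Fin n → ℝ) : ℝ :=
  sInf {x | ∃ P : Matrix (Fin n) (Fin n) ℝ, IsPlan p q P ∧ x = Lfun lam M P}


noncomputable def Ffun {n : ℕ} (lam : ℝ) (M P : Matrix (Fin n) (Fin n) ℝ) : ℝ :=
  ∑ i, ∑ j, (M i j * P i j + lam * (P i j * Real.log (P i j)))

lemma Lfun_eq {n : ℕ} (lam : ℝ) (M P : Matrix (Fin n) (Fin n) ℝ) :
    Lfun lam M P = (1 / (1 + lam)) * Ffun lam M P := by
  unfold Lfun Ffun cost entM
  simp only [Finset.sum_add_distrib, ← Finset.mul_sum]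
  ring

lemma isPlan_prod {n : ℕ} {p q : Fin n → ℝ} (hp : IsSimplex p) (hq : IsSimplex q) :
    IsPlan p q (fun i j => p i * q j) := by
  refine ⟨fun i j => (mul_pos (hp.1 i) (hq.1 j)).le, fun i => ?_, fun j => ?_⟩
  · rw [← Finset.mul_sum, hq.2, mul_one]
  · rw [← Finset.sum_mul, hp.2, one_mul]

lemma exists_min {n : ℕ} (lam : ℝ) (M : Matrix (Fin n) (Fin n) ℝ)
    (p q : Fin n → ℝ) (hp : IsSimplex p) (hq : IsSimplex q) :
    ∃ P : Matrix (Fin n) (Fin n) ℝ, IsPlan p q P ∧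
      ∀ Q : Matrix (Fin n) (Fin n) ℝ, IsPlan p q Q → Ffun lam M P ≤ Ffun lam M Q := by
  have hent : ∀ i j : Fin n, Continuous (fun P : Fin n → Fin n → ℝ => P i j) := fun i j =>
    (continuous_apply j).comp (continuous_apply i)
  have hcl : IsClosed {P : Fin n → Fin n → ℝ | IsPlan p q P} := by
    have : {P : Fin n → Fin n → ℝ | IsPlan p q P} =
        (⋂ i, ⋂ j, {P | 0 ≤ P i j}) ∩ ((⋂ i, {P | ∑ j, P i j = p i}) ∩
          (⋂ j, {P | ∑ i, P i j = q j})) := by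
      ext P
      simp [IsPlan]
    rw [this]
    refine IsClosed.inter ?_ (IsClosed.inter ?_ ?_)
    · exact isClosed_iInter fun i => isClosed_iInter fun j =>
        isClosed_le continuous_const (hent i j)
    · exact isClosed_iInter fun i => isClosed_eq
        (continuous_finsetSum _ fun j _ => hent i j) continuous_const
    · exact isClosed_iInter fun j => isClosed_eq
        (continuous_finsetSum _ fun i _ => hent i j) continuous_const
  have hK : IsCompact {P : Fin n → Fin n → ℝ | IsPlan p q P} := by
    refine IsCompact.of_isClosed_subset
      (isCompact_Icc (a := (fun _ _ => 0 : Fin n → Fin n → ℝ)) (b := fun i _ => p i)) hcl ?_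
    intro P hP
    refine ⟨fun i j => hP.1 i j, fun i j => ?_⟩
    change P i j ≤ p i
    rw [← hP.2.1 i]
    exact Finset.single_le_sum (f := fun j => P i j) (fun j _ => hP.1 i j) (Finset.mem_univ j)
  have hcont : Continuous (fun P : Fin n → Fin n → ℝ => Ffun lam M P) := by
    unfold Ffun
    refine continuous_finsetSum _ fun i _ => continuous_finsetSum _ fun j _ => ?_
    exact (continuous_const.mul (hent i j)).add
      (continuous_const.mul (Real.continuous_mul_log.comp (hent i j)))
  obtain ⟨P, hP, hmin⟩ := hK.exists_isMinOn ⟨_, isPlan_prod hp hq⟩ hcont.continuousOn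
  exact ⟨P, hP, fun Q hQ => hmin hQ⟩

lemma min_pos {n : ℕ} (lam : ℝ) (hlam : 0 < lam) (M : Matrix (Fin n) (Fin n) ℝ)
    (p q : Fin n → ℝ) (hp : IsSimplex p) (hq : IsSimplex q)
    (P : Matrix (Fin n) (Fin n) ℝ) (hP : IsPlan p q P)
    (hmin : ∀ Q : Matrix (Fin n) (Fin n) ℝ, IsPlan p q Q → Ffun lam M P ≤ Ffun lam M Q) :
    ∀ i j, 0 < P i j := by
  intro i₀ j₀
  by_contra hneg
  have h0 : P i₀ j₀ = 0 := le_antisymm (not_lt.mp hneg) (hP.1 i₀ j₀)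
  set R : Matrix (Fin n) (Fin n) ℝ := fun i j => p i * q j with hR
  have hRp : IsPlan p q R := isPlan_prod hp hq
  have hRpos : ∀ i j, 0 < R i j := fun i j => mul_pos (hp.1 i) (hq.1 j)
  have key : ∀ t : ℝ, 0 < t → t < 1 →
      0 ≤ t * (Ffun lam M R - Ffun lam M P) + lam * (t * R i₀ j₀ * Real.log t) := by
    intro t ht ht1
    set Q : Matrix (Fin n) (Fin n) ℝ := fun i j => (1 - t) * P i j + t * R i j with hQ
    have hQp : IsPlan p q Q := by
      refine ⟨fun i j => ?_, fun i => ?_, fun j => ?_⟩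
      · have := hP.1 i j
        have := (hRpos i j).le
        have : 0 ≤ 1 - t := by linarith
        simp only [hQ]; positivity
      · simp only [hQ, Finset.sum_add_distrib, ← Finset.mul_sum, hP.2.1, hRp.2.1]; ring
      · simp only [hQ, Finset.sum_add_distrib, ← Finset.mul_sum, hP.2.2, hRp.2.2]; ring
    have h1 := hmin Q hQp
    have h2 : Ffun lam M Q ≤ (1 - t) * Ffun lam M P + t * Ffun lam M R +
        ∑ i, ∑ j, (if i = i₀ then (if j = j₀ then lam * (t * R i₀ j₀ * Real.log t) else 0)
          else 0) := by
      unfold Ffun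
      simp only [Finset.mul_sum, ← Finset.sum_add_distrib]
      refine Finset.sum_le_sum fun i _ => Finset.sum_le_sum fun j _ => ?_
      by_cases hij : i = i₀ ∧ j = j₀
      · obtain ⟨rfl, rfl⟩ := hij
        simp only [hQ, h0, if_true]
        simp only [mul_zero, zero_add, zero_mul, add_zero]
        rw [Real.log_mul ht.ne' (hRpos _ _).ne']
        apply le_of_eq; ring
      · have hz : (if i = i₀ then (if j = j₀ then lam * (t * R i₀ j₀ * Real.log t) else 0)
          else 0) = 0 := by
          split_ifs with h h' <;> first | rfl | exact absurd ⟨h, h'⟩ hij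
        rw [hz]
        have hc := Real.convexOn_mul_log.2 (show P i j ∈ Set.Ici 0 from hP.1 i j)
          (show R i j ∈ Set.Ici 0 from (hRpos i j).le) (show 0 ≤ 1 - t by linarith) ht.le
          (by ring)
        simp only [smul_eq_mul] at hc
        have := mul_le_mul_of_nonneg_left hc hlam.le
        simp only [hQ]
        linarith
    simp only [Finset.sum_ite_eq', Finset.mem_univ, if_true, Finset.sum_ite_irrel,
      Finset.sum_const_zero] at h2
    linarith
  set A := Ffun lam M R - Ffun lam M P with hA
  have hr := hRpos i₀ j₀
  set K : ℝ := (|A| + 1) / (lam * R i₀ j₀) with hKd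
  have hK : 0 < K := by positivity
  have hk := key (Real.exp (-K)) (Real.exp_pos _) (by rw [Real.exp_lt_one_iff]; linarith)
  rw [Real.log_exp] at hk
  have hKe : lam * R i₀ j₀ * K = |A| + 1 := by rw [hKd]; field_simp
  have h3 : 0 ≤ Real.exp (-K) * (A - (|A| + 1)) := by rw [← hKe]; linarith
  have h4 : A - (|A| + 1) < 0 := by linarith [le_abs_self A]
  have := mul_neg_of_pos_of_neg (Real.exp_pos (-K)) h4
  linarith

lemma min_stat {n : ℕ} (lam : ℝ) (M : Matrix (Fin n) (Fin n) ℝ)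
    (p q : Fin n → ℝ)
    (P : Matrix (Fin n) (Fin n) ℝ) (hP : IsPlan p q P)
    (hmin : ∀ Q : Matrix (Fin n) (Fin n) ℝ, IsPlan p q Q → Ffun lam M P ≤ Ffun lam M Q)
    (hpos : ∀ i j, 0 < P i j) (D : Matrix (Fin n) (Fin n) ℝ)
    (hD1 : ∀ i, ∑ j, D i j = 0) (hD2 : ∀ j, ∑ i, D i j = 0) :
    ∑ i, ∑ j, D i j * (M i j + lam * (Real.log (P i j) + 1)) = 0 := by
  have hder : HasDerivAt (fun t : ℝ => Ffun lam M (fun i j => P i j + t * D i j))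
      (∑ i, ∑ j, D i j * (M i j + lam * (Real.log (P i j) + 1))) 0 := by
    unfold Ffun
    refine HasDerivAt.fun_sum fun i _ => HasDerivAt.fun_sum fun j _ => ?_
    have h1 : HasDerivAt (fun t : ℝ => P i j + t * D i j) (D i j) 0 := by
      simpa using ((hasDerivAt_id (0 : ℝ)).mul_const (D i j)).const_add (P i j)
    have h2 : HasDerivAt (fun x : ℝ => x * Real.log x) (Real.log (P i j) + 1)
        (P i j + 0 * D i j) := by
      simpa using Real.hasDerivAt_mul_log (hpos i j).ne'
    have h3 := (h1.const_mul (M i j)).add ((h2.comp 0 h1).const_mul lam)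
    refine h3.congr_deriv ?_
    ring
  refine IsLocalMin.hasDerivAt_eq_zero ?_ hder
  have hev : ∀ᶠ t : ℝ in nhds 0, ∀ i j, 0 < P i j + t * D i j := by
    refine Filter.eventually_all.2 fun i => Filter.eventually_all.2 fun j => ?_
    have hc : Continuous (fun t : ℝ => P i j + t * D i j) := by fun_prop
    exact (hc.tendsto 0).eventually (lt_mem_nhds (by simpa using hpos i j))
  filter_upwards [hev] with t ht
  have := hmin (fun i j => P i j + t * D i j) ⟨fun i j => (ht i j).le, fun i => by
    rw [Finset.sum_add_distrib, ← Finset.mul_sum, hD1, hP.2.1]; ring, fun j => by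
    rw [Finset.sum_add_distrib, ← Finset.mul_sum, hD2, hP.2.2]; ring⟩
  simpa using this

/-- Theorem 1: `L_λ` attains its minimum over `U(p,q)` at an entrywise
strictly positive plan `P*` of the form `P*_ij = c a_i b_j exp(-m_ij/λ)` with
`a, b > 0` and `c = 1 / Σ a_i b_j exp(-m_ij/λ)`. -/
theorem stmt2 {n : ℕ} (hn : 2 ≤ n) (lam : ℝ) (hlam : 0 < lam)
    (M : Matrix (Fin n) (Fin n) ℝ) (hM : ∀ i j, 0 ≤ M i j)
    (p q : Fin n → ℝ) (hp : IsSimplex p) (hq : IsSimplex q) :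
    ∃ P : Matrix (Fin n) (Fin n) ℝ, IsPlan p q P ∧
      (∀ Q : Matrix (Fin n) (Fin n) ℝ, IsPlan p q Q → Lfun lam M P ≤ Lfun lam M Q) ∧
      (∀ i j, 0 < P i j) ∧
      ∃ a b : Fin n → ℝ, (∀ i, 0 < a i) ∧ (∀ j, 0 < b j) ∧
        ∃ c : ℝ, 0 < c ∧
          c = 1 / (∑ i, ∑ j, a i * b j * Real.exp (-M i j / lam)) ∧
          ∀ i j, P i j = c * a i * b j * Real.exp (-M i j / lam) := by
  obtain ⟨P, hP, hmin⟩ := exists_min lam M p q hp hq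
  have hpos := min_pos lam hlam M p q hp hq P hP hmin
  have hl1 : 0 < 1 + lam := by linarith
  refine ⟨P, hP, fun Q hQ => ?_, hpos, ?_⟩
  · rw [Lfun_eq, Lfun_eq]
    exact mul_le_mul_of_nonneg_left (hmin Q hQ) (by positivity)
  let z : Fin n := ⟨0, by omega⟩
  set G : Fin n → Fin n → ℝ := fun i j => M i j + lam * (Real.log (P i j) + 1) with hG
  have hst : ∀ i j, G i j = G i z + (G z j - G z z) := by
    intro i j
    have h := min_stat lam M p q P hP hmin hpos
      (fun k l => ((if k = i then 1 else 0) - (if k = z then 1 else 0)) *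
        ((if l = j then 1 else 0) - (if l = z then 1 else 0)))
      (fun k => by rw [← Finset.mul_sum, Finset.sum_sub_distrib]; simp)
      (fun k => by rw [← Finset.sum_mul, Finset.sum_sub_distrib]; simp)
    change ∑ k, ∑ l, _ * G k l = 0 at h
    simp only [mul_assoc, ← Finset.mul_sum] at h
    simp only [sub_mul, Finset.sum_sub_distrib, ite_mul, one_mul, zero_mul, Finset.sum_ite_eq',
      Finset.mem_univ, if_true] at h
    linarith
  have hform : ∀ i j, P i j = Real.exp (G i z / lam - 1) * Real.exp ((G z j - G z z) / lam) *
      Real.exp (-M i j / lam) := by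
    intro i j
    rw [← Real.exp_add, ← Real.exp_add]
    have : G i z / lam - 1 + (G z j - G z z) / lam + -M i j / lam = Real.log (P i j) := by
      have h1 := hst i j
      have h2 : G i j = M i j + lam * (Real.log (P i j) + 1) := rfl
      have h3 : G i z / lam - 1 + (G z j - G z z) / lam + -M i j / lam
        = (G i z + (G z j - G z z) - M i j) / lam - 1 := by ring
      rw [h3, ← h1, h2]
      field_simp
      ring
    rw [this, Real.exp_log (hpos i j)]
  refine ⟨fun i => Real.exp (G i z / lam - 1), fun j => Real.exp ((G z j - G z z) / lam),
    fun i => Real.exp_pos _, fun j => Real.exp_pos _, 1, one_pos, ?_, fun i j => ?_⟩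
  · simp only [← hform, hP.2.1, hp.2]; norm_num
  · rw [one_mul]; exact hform i j
end

section
/- (Theorem 2) Let λ > 0 and let M ∈ ℝ^{n×n} have nonnegative entries. The Cuturi function C_λ is jointly convex on S_{n-1} × S_{n-1}: for all p₁, p₂, q₁, q₂ ∈ S_{n-1} and all ν ∈ [0,1], C_λ(ν p₁ + (1-ν) p₂, ν q₁ + (1-ν) q₂) ≤ ν C_λ(p₁, q₁) + (1-ν) C_λ(p₂, q₂). -/
open Finset Real

lemma aux_conv {n : ℕ} (lam : ℝ) (hlam : 0 < lam) (M P Q : Matrix (Fin n) (Fin n) ℝ)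
    (hP : ∀ i j, 0 ≤ P i j) (hQ : ∀ i j, 0 ≤ Q i j) (ν : ℝ) (hν : ν ∈ Set.Icc (0 : ℝ) 1) :
    Lfun lam M (fun i j => ν * P i j + (1 - ν) * Q i j) ≤
      ν * Lfun lam M P + (1 - ν) * Lfun lam M Q := by
  have hc : cost M (fun i j => ν * P i j + (1 - ν) * Q i j) =
      ν * cost M P + (1 - ν) * cost M Q := by
    simp only [cost, Finset.mul_sum, ← Finset.sum_add_distrib]
    refine Finset.sum_congr rfl fun i _ => Finset.sum_congr rfl fun j _ => by ring
  have he : ν * entM P + (1 - ν) * entM Q ≤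
      entM (fun i j => ν * P i j + (1 - ν) * Q i j) := by
    have : ∑ i, ∑ j, (ν * P i j + (1 - ν) * Q i j) * Real.log (ν * P i j + (1 - ν) * Q i j) ≤
        ν * (∑ i, ∑ j, P i j * Real.log (P i j)) +
          (1 - ν) * ∑ i, ∑ j, Q i j * Real.log (Q i j) := by
      simp only [Finset.mul_sum, ← Finset.sum_add_distrib]
      refine Finset.sum_le_sum fun i _ => Finset.sum_le_sum fun j _ => ?_
      have := Real.convexOn_mul_log.2 (Set.mem_Ici.2 (hP i j)) (Set.mem_Ici.2 (hQ i j))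
        hν.1 (sub_nonneg.2 hν.2) (by ring)
      simpa [smul_eq_mul] using this
    simp only [entM]
    linarith
  have hl : 0 ≤ lam / (1 + lam) := by positivity
  have := mul_le_mul_of_nonneg_left he hl
  simp only [Lfun, hc]
  linarith

lemma aux_bdd {n : ℕ} (lam : ℝ) (hlam : 0 < lam) (M : Matrix (Fin n) (Fin n) ℝ)
    (hM : ∀ i j, 0 ≤ M i j) (p q : Fin n → ℝ) :
    BddBelow {x | ∃ P : Matrix (Fin n) (Fin n) ℝ, IsPlan p q P ∧ x = Lfun lam M P} := by
  refine ⟨-((lam / (1 + lam)) * ∑ _i : Fin n, ∑ _j : Fin n, (1 : ℝ)), ?_⟩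
  rintro x ⟨P, hP, rfl⟩
  have hc : 0 ≤ cost M P := Finset.sum_nonneg fun i _ => Finset.sum_nonneg fun j _ =>
    mul_nonneg (hM i j) (hP.1 i j)
  have he : entM P ≤ ∑ _i : Fin n, ∑ _j : Fin n, (1 : ℝ) := by
    simp only [entM, ← Finset.sum_neg_distrib]
    refine Finset.sum_le_sum fun i _ => Finset.sum_le_sum fun j _ => ?_
    have h0 := hP.1 i j
    rcases h0.eq_or_lt with h | h
    · simp [← h]
    · have h1 := Real.one_sub_inv_le_log_of_pos h
      have h2 := mul_le_mul_of_nonneg_left h1 h0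
      rw [mul_sub, mul_inv_cancel₀ h.ne'] at h2
      linarith
  have hl : 0 ≤ lam / (1 + lam) := by positivity
  have hl' : 0 ≤ 1 / (1 + lam) := by positivity
  have h1 := mul_le_mul_of_nonneg_left he hl
  have h2 := mul_nonneg hl' hc
  simp only [Lfun]
  linarith

lemma aux_ne {n : ℕ} (lam : ℝ) (M : Matrix (Fin n) (Fin n) ℝ)
    (p q : Fin n → ℝ) (hp : IsSimplex p) (hq : IsSimplex q) :
    {x | ∃ P : Matrix (Fin n) (Fin n) ℝ, IsPlan p q P ∧ x = Lfun lam M P}.Nonempty := by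
  refine ⟨_, fun i j => p i * q j, ⟨fun i j => mul_nonneg (hp.1 i).le (hq.1 j).le,
    fun i => ?_, fun j => ?_⟩, rfl⟩
  · rw [← Finset.mul_sum, hq.2, mul_one]
  · rw [← Finset.sum_mul, hp.2, one_mul]

/-- Theorem 2: The Cuturi function `C_λ` is jointly convex on
`S_{n-1} × S_{n-1}`. -/
theorem stmt4 {n : ℕ} (hn : 2 ≤ n) (lam : ℝ) (hlam : 0 < lam)
    (M : Matrix (Fin n) (Fin n) ℝ) (hM : ∀ i j, 0 ≤ M i j)
    (p₁ p₂ q₁ q₂ : Fin n → ℝ)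
    (hp₁ : IsSimplex p₁) (hp₂ : IsSimplex p₂) (hq₁ : IsSimplex q₁) (hq₂ : IsSimplex q₂)
    (ν : ℝ) (hν : ν ∈ Set.Icc (0 : ℝ) 1) :
    Cfun lam M (fun i => ν * p₁ i + (1 - ν) * p₂ i) (fun j => ν * q₁ j + (1 - ν) * q₂ j) ≤
      ν * Cfun lam M p₁ q₁ + (1 - ν) * Cfun lam M p₂ q₂ := by
  refine le_of_forall_pos_le_add fun ε hε => ?_
  obtain ⟨_, ⟨P, hP, rfl⟩, hPl⟩ := Real.lt_sInf_add_pos (aux_ne lam M p₁ q₁ hp₁ hq₁) hε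
  obtain ⟨_, ⟨Q, hQ, rfl⟩, hQl⟩ := Real.lt_sInf_add_pos (aux_ne lam M p₂ q₂ hp₂ hq₂) hε
  have h0 : 0 ≤ 1 - ν := sub_nonneg.2 hν.2
  have h1 := aux_conv lam hlam M P Q hP.1 hQ.1 ν hν
  have h2 : Cfun lam M (fun i => ν * p₁ i + (1 - ν) * p₂ i)
      (fun j => ν * q₁ j + (1 - ν) * q₂ j) ≤
      Lfun lam M (fun i j => ν * P i j + (1 - ν) * Q i j) := by
    refine csInf_le (aux_bdd lam hlam M hM _ _) ⟨_, ⟨fun i j => ?_, fun i => ?_, fun j => ?_⟩, rfl⟩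
    · exact add_nonneg (mul_nonneg hν.1 (hP.1 i j)) (mul_nonneg h0 (hQ.1 i j))
    · rw [Finset.sum_add_distrib, ← Finset.mul_sum, ← Finset.mul_sum, hP.2.1, hQ.2.1]
    · rw [Finset.sum_add_distrib, ← Finset.mul_sum, ← Finset.mul_sum, hP.2.2, hQ.2.2]
  have h3 := mul_le_mul_of_nonneg_left hPl.le hν.1
  have h4 := mul_le_mul_of_nonneg_left hQl.le h0
  change ν * _ ≤ ν * (Cfun lam M p₁ q₁ + ε) at h3
  change (1 - ν) * _ ≤ (1 - ν) * (Cfun lam M p₂ q₂ + ε) at h4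
  linarith
end

section
/- (Theorem 3) Let λ > 0, let M ∈ ℝ^{n×n} have nonnegative entries, and let α, β ∈ ℝ^n. Define ψ_λ(α,β) = (λ/(1+λ)) log Σ_{ij} exp( ((1+λ)/λ)(α_i + β_j) - m_ij/λ ), and define the plan P by P_ij = exp( ((1+λ)/λ)(α_i + β_j) - m_ij/λ - ((1+λ)/λ) ψ_λ(α,β) ). Let p_i = Σ_j P_ij and q_j = Σ_i P_ij be its marginals. Then Σ_i p_i α_i + Σ_j q_j β_j - ψ_λ(α,β) = C_λ(p,q); that is, the Legendre dual potential φ_λ(p,q) equals the Cuturi function, and P is the minimizer defining C_λ(p,q). -/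
open Finset Real

theorem aux_gibbs (x y : ℝ) (hx : 0 ≤ x) (hy : 0 < y) :
    x * Real.log y + (x - y) ≤ x * Real.log x := by
  rcases hx.eq_or_lt with h | h
  · subst h
    simp
    exact hy.le
  · have h1 := Real.log_le_sub_one_of_pos (div_pos hy h)
    rw [Real.log_div hy.ne' h.ne'] at h1
    have h2 := mul_le_mul_of_nonneg_left h1 hx
    have h3 : x * (y / x - 1) = y - x := by field_simp
    rw [h3] at h2
    linarith

/-- Theorem 3: the Legendre dual potential equals the Cuturi function.
With `ψ_λ(α,β) = (λ/(1+λ)) log Σ exp(((1+λ)/λ)(α_i+β_j) - m_ij/λ)` and the plan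
`P_ij = exp(((1+λ)/λ)(α_i+β_j) - m_ij/λ - ((1+λ)/λ)ψ_λ)` with marginals `(p,q)`,
we have `p·α + q·β - ψ_λ(α,β) = C_λ(p,q)`, and `P` is the minimizer defining `C_λ(p,q)`. -/
theorem stmt5 {n : ℕ} (hn : 2 ≤ n) (lam : ℝ) (hlam : 0 < lam)
    (M : Matrix (Fin n) (Fin n) ℝ) (hM : ∀ i j, 0 ≤ M i j)
    (α β : Fin n → ℝ)
    (ψ : ℝ)
    (hψ : ψ = (lam / (1 + lam)) *
      Real.log (∑ i, ∑ j, Real.exp ((1 + lam) / lam * (α i + β j) - M i j / lam)))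
    (P : Matrix (Fin n) (Fin n) ℝ)
    (hP : ∀ i j, P i j =
      Real.exp ((1 + lam) / lam * (α i + β j) - M i j / lam - (1 + lam) / lam * ψ))
    (p q : Fin n → ℝ)
    (hpdef : ∀ i, p i = ∑ j, P i j) (hqdef : ∀ j, q j = ∑ i, P i j) :
    (∑ i, p i * α i) + (∑ j, q j * β j) - ψ = Cfun lam M p q ∧
      IsPlan p q P ∧
      Lfun lam M P = Cfun lam M p q ∧
      (∀ Q : Matrix (Fin n) (Fin n) ℝ, IsPlan p q Q → Lfun lam M P ≤ Lfun lam M Q) := by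
  have hl1 : (0:ℝ) < 1 + lam := by linarith
  have hPpos : ∀ i j, 0 < P i j := fun i j => by rw [hP]; exact Real.exp_pos _
  have hlog : ∀ i j, lam / (1 + lam) * Real.log (P i j)
      = α i + β j - ψ - 1 / (1 + lam) * M i j := by
    intro i j
    rw [hP, Real.log_exp]
    field_simp
    ring
  have hplan : IsPlan p q P :=
    ⟨fun i j => (hPpos i j).le, fun i => (hpdef i).symm, fun j => (hqdef j).symm⟩
  have hne : Nonempty (Fin n) := ⟨⟨0, by omega⟩⟩
  have hSpos : 0 < ∑ i, ∑ j, Real.exp ((1 + lam) / lam * (α i + β j) - M i j / lam) :=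
    Finset.sum_pos (fun i _ => Finset.sum_pos (fun j _ => Real.exp_pos _)
      Finset.univ_nonempty) Finset.univ_nonempty
  have hsum : ∑ i, ∑ j, P i j = 1 := by
    have h1 : Real.exp ((1 + lam) / lam * ψ)
        = ∑ i, ∑ j, Real.exp ((1 + lam) / lam * (α i + β j) - M i j / lam) := by
      have : (1 + lam) / lam * ψ =
        Real.log (∑ i, ∑ j, Real.exp ((1 + lam) / lam * (α i + β j) - M i j / lam)) := by
        rw [hψ]; field_simp
      rw [this, Real.exp_log hSpos]
    simp_rw [hP, Real.exp_sub _ ((1 + lam) / lam * ψ), ← Finset.sum_div]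
    rw [h1]
    exact div_self hSpos.ne'
  have hsumQ : ∀ Q : Matrix (Fin n) (Fin n) ℝ, IsPlan p q Q → ∑ i, ∑ j, Q i j = 1 := by
    intro Q hQ
    rw [← hsum]
    exact Finset.sum_congr rfl fun i _ => by rw [hQ.2.1, hpdef]
  have hlin : ∀ Q : Matrix (Fin n) (Fin n) ℝ, IsPlan p q Q →
      ∑ i, ∑ j, Q i j * (α i + β j - ψ) =
        (∑ i, p i * α i) + (∑ j, q j * β j) - ψ := by
    intro Q hQ
    have e1 : ∑ i, ∑ j, Q i j * α i = ∑ i, p i * α i :=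
      Finset.sum_congr rfl fun i _ => by rw [← Finset.sum_mul, hQ.2.1]
    have e2 : ∑ i, ∑ j, Q i j * β j = ∑ j, q j * β j := by
      rw [Finset.sum_comm]
      exact Finset.sum_congr rfl fun j _ => by rw [← Finset.sum_mul, hQ.2.2]
    have e3 : ∑ i, ∑ j, Q i j * ψ = ψ := by
      simp_rw [← Finset.sum_mul]
      rw [hsumQ Q hQ, one_mul]
    simp_rw [mul_sub, mul_add, Finset.sum_sub_distrib, Finset.sum_add_distrib]
    rw [e1, e2, e3]
  have hL : ∀ Q : Matrix (Fin n) (Fin n) ℝ, Lfun lam M Q =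
      ∑ i, ∑ j, (1 / (1 + lam) * (M i j * Q i j)
        + lam / (1 + lam) * (Q i j * Real.log (Q i j))) := by
    intro Q
    simp_rw [Lfun, cost, entM, Finset.sum_add_distrib, ← Finset.mul_sum]
    ring
  have hLP : Lfun lam M P = (∑ i, p i * α i) + (∑ j, q j * β j) - ψ := by
    rw [hL, ← hlin P hplan]
    refine Finset.sum_congr rfl fun i _ => Finset.sum_congr rfl fun j _ => ?_
    linear_combination P i j * hlog i j
  have hmin : ∀ Q : Matrix (Fin n) (Fin n) ℝ, IsPlan p q Q →
      Lfun lam M P ≤ Lfun lam M Q := by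
    intro Q hQ
    have h0 : ∑ i, ∑ j, lam / (1 + lam) * (Q i j - P i j) = 0 := by
      simp_rw [← Finset.mul_sum, Finset.sum_sub_distrib]
      rw [hsumQ Q hQ, hsum]
      simp
    rw [hLP, ← hlin Q hQ, hL,
      ← add_zero (∑ i, ∑ j, Q i j * (α i + β j - ψ)), ← h0, ← Finset.sum_add_distrib]
    refine Finset.sum_le_sum fun i _ => ?_
    rw [← Finset.sum_add_distrib]
    refine Finset.sum_le_sum fun j _ => ?_
    have h1 := mul_le_mul_of_nonneg_left (aux_gibbs (Q i j) (P i j) (hQ.1 i j) (hPpos i j))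
      (div_pos hlam hl1).le
    have h2 : Q i j * (lam / (1 + lam) * Real.log (P i j))
        = Q i j * (α i + β j - ψ - 1 / (1 + lam) * M i j) := by rw [hlog]
    linarith
  have hC : Lfun lam M P = Cfun lam M p q := by
    have : IsLeast {x | ∃ P : Matrix (Fin n) (Fin n) ℝ, IsPlan p q P ∧ x = Lfun lam M P}
        (Lfun lam M P) := by
      refine ⟨⟨P, hplan, rfl⟩, ?_⟩
      rintro x ⟨Q, hQ, rfl⟩
      exact hmin Q hQ
    exact this.csInf_eq.symm
  exact ⟨hLP ▸ hC, hplan, hC, hmin⟩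
end

section
/- (Theorem 6) Let λ > 0, let M ∈ ℝ^{n×n} have nonnegative entries, and let p, q ∈ S_{n-1}. Let P*(p,p) and P*(p,q) denote the minimizers of L_λ over U(p,p) and U(p,q) respectively, and write P*(p,q)_ij = exp( ((1+λ)/λ)(α_i + β_j) - m_ij/λ - ((1+λ)/λ)ψ ) for Lagrange multiplier vectors α, β ∈ ℝ^n and normalization ψ. Then the λ-divergence D_λ[p:q] = (λ/(1+λ)) · KL[P*(p,p) : P*(p,q)] satisfies D_λ[p:q] = C_λ(p,p) - C_λ(p,q) - Σ_j β_j (p_j - q_j); i.e., D_λ is the Bregman-like divergence constructed from the Cuturi function with ∇_q C_λ(p,q) = β. -/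
open Finset Real

theorem aux_Cfun {n : ℕ} (lam : ℝ) (M : Matrix (Fin n) (Fin n) ℝ) (p q : Fin n → ℝ)
    (P : Matrix (Fin n) (Fin n) ℝ) (hP : IsPlan p q P)
    (hmin : ∀ Q : Matrix (Fin n) (Fin n) ℝ, IsPlan p q Q → Lfun lam M P ≤ Lfun lam M Q) :
    Cfun lam M p q = Lfun lam M P := by
  unfold Cfun
  apply IsLeast.csInf_eq
  refine ⟨⟨P, hP, rfl⟩, ?_⟩
  rintro x ⟨Q, hQ, rfl⟩
  exact hmin Q hQ

theorem aux_key {n : ℕ} (lam : ℝ) (hlam : 0 < lam)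
    (M : Matrix (Fin n) (Fin n) ℝ) (p r : Fin n → ℝ) (hp : IsSimplex p)
    (P Q : Matrix (Fin n) (Fin n) ℝ) (hP : IsPlan p r P)
    (α β : Fin n → ℝ) (ψ : ℝ)
    (hform : ∀ i j, Q i j =
      Real.exp ((1 + lam) / lam * (α i + β j) - M i j / lam - (1 + lam) / lam * ψ)) :
    Lfun lam M P - (lam / (1 + lam)) * klM P Q =
      ∑ i, α i * p i + ∑ j, β j * r j - ψ := by
  have h1 : ∑ i, α i * p i = ∑ i, ∑ j, α i * P i j := by
    refine Finset.sum_congr rfl fun i _ => ?_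
    rw [← Finset.mul_sum, hP.2.1 i]
  have h2 : ∑ j, β j * r j = ∑ i, ∑ j, β j * P i j := by
    rw [Finset.sum_comm]
    refine Finset.sum_congr rfl fun j _ => ?_
    rw [← Finset.mul_sum, hP.2.2 j]
  have h3 : ψ = ∑ i, ∑ j, ψ * P i j := by
    simp_rw [← Finset.mul_sum, hP.2.1]
    rw [hp.2, mul_one]
  rw [h1, h2]
  conv_rhs => rw [h3]
  unfold Lfun cost entM klM
  rw [mul_neg, sub_neg_eq_add]
  simp only [Finset.mul_sum]
  simp only [← Finset.sum_add_distrib, ← Finset.sum_sub_distrib]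
  refine Finset.sum_congr rfl fun i _ => Finset.sum_congr rfl fun j _ => ?_
  rcases (hP.1 i j).eq_or_lt with h | h
  · rw [← h]; simp
  · have hQ : Q i j ≠ 0 := by rw [hform]; exact (Real.exp_pos _).ne'
    rw [Real.log_div h.ne' hQ, hform, Real.log_exp]
    have : 1 + lam ≠ 0 := by positivity
    field_simp
    ring

/-- Theorem 6: the λ-divergence `D_λ[p:q] = (λ/(1+λ)) KL[P*(p,p) : P*(p,q)]`
is the Bregman-like divergence of the Cuturi function:
`D_λ[p:q] = C_λ(p,p) - C_λ(p,q) - β · (p - q)`, where `β = ∇_q C_λ(p,q)` is the Lagrange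
multiplier vector of the optimal plan `P*(p,q)`. -/
theorem stmt8 {n : ℕ} (hn : 2 ≤ n) (lam : ℝ) (hlam : 0 < lam)
    (M : Matrix (Fin n) (Fin n) ℝ) (hM : ∀ i j, 0 ≤ M i j)
    (p q : Fin n → ℝ) (hp : IsSimplex p) (hq : IsSimplex q)
    (Ppp Ppq : Matrix (Fin n) (Fin n) ℝ)
    (hPpp : IsPlan p p Ppp)
    (hminpp : ∀ Q : Matrix (Fin n) (Fin n) ℝ, IsPlan p p Q → Lfun lam M Ppp ≤ Lfun lam M Q)
    (hPpq : IsPlan p q Ppq)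
    (hminpq : ∀ Q : Matrix (Fin n) (Fin n) ℝ, IsPlan p q Q → Lfun lam M Ppq ≤ Lfun lam M Q)
    (α β : Fin n → ℝ) (ψ : ℝ)
    (hform : ∀ i j, Ppq i j =
      Real.exp ((1 + lam) / lam * (α i + β j) - M i j / lam - (1 + lam) / lam * ψ)) :
    (lam / (1 + lam)) * klM Ppp Ppq =
      Cfun lam M p p - Cfun lam M p q - ∑ j, β j * (p j - q j) := by
  have e1 := aux_key lam hlam M p p hp Ppp Ppq hPpp α β ψ hform
  have e2 := aux_key lam hlam M p q hp Ppq Ppq hPpq α β ψ hform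
  have e3 : klM Ppq Ppq = 0 := by
    unfold klM
    refine Finset.sum_eq_zero fun i _ => Finset.sum_eq_zero fun j _ => ?_
    have hQ : Ppq i j ≠ 0 := by rw [hform]; exact (Real.exp_pos _).ne'
    rw [div_self hQ, Real.log_one, mul_zero]
  rw [e3] at e2
  rw [aux_Cfun lam M p p Ppp hPpp hminpp, aux_Cfun lam M p q Ppq hPpq hminpq]
  simp only [mul_sub, Finset.sum_sub_distrib]
  linarith
end

section
/- Let M ∈ ℝ^{n×n} have nonnegative entries and let p, q ∈ S_{n-1}. For λ > 0 let P*_λ(p,q) denote the unique minimizer of L_λ over U(p,q). Then as λ → ∞, P*_λ(p,q) converges to the product plan p⊗q, i.e., P*_λ(p,q)_ij → p_i q_j for all i, j. -/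
open Finset Real

theorem aux_pt (x r : ℝ) (hx : 0 ≤ x) (hx1 : x ≤ 1) (hr : 0 < r) (hr1 : r ≤ 1) :
    (x - r) ^ 2 / 4 ≤ x * Real.log x - x * Real.log r - x + r := by
  obtain ⟨a, ha, rfl⟩ : ∃ a : ℝ, 0 ≤ a ∧ x = a ^ 2 := ⟨√x, Real.sqrt_nonneg x, (Real.sq_sqrt hx).symm⟩
  obtain ⟨b, hb, rfl⟩ : ∃ b : ℝ, 0 < b ∧ r = b ^ 2 :=
    ⟨√r, Real.sqrt_pos.2 hr, (Real.sq_sqrt hr.le).symm⟩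
  have ha1 : a ≤ 1 := by nlinarith
  have hb1 : b ≤ 1 := by nlinarith
  have key : 2 * a ^ 2 - 2 * a * b ≤ a ^ 2 * Real.log (a ^ 2) - a ^ 2 * Real.log (b ^ 2) := by
    rcases ha.eq_or_lt with h | h
    · subst h; simp
    · have h1 := Real.log_le_sub_one_of_pos (div_pos hb h)
      rw [Real.log_div hb.ne' h.ne'] at h1
      have h2 := mul_le_mul_of_nonneg_left h1 (sq_nonneg a)
      have h3 : a ^ 2 * (b / a - 1) = a * b - a ^ 2 := by field_simp
      rw [h3] at h2
      rw [Real.log_pow, Real.log_pow]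
      push_cast
      linarith
  have h4 : (a + b) ^ 2 ≤ 4 := by nlinarith
  have h5 := mul_le_mul_of_nonneg_left h4 (sq_nonneg (a - b))
  nlinarith

theorem aux_log {n : ℕ} (p q : Fin n → ℝ) (hp : IsSimplex p) (hq : IsSimplex q)
    (P : Matrix (Fin n) (Fin n) ℝ) (hP : IsPlan p q P) :
    ∑ i, ∑ j, P i j * Real.log (p i * q j)
      = ∑ i, p i * Real.log (p i) + ∑ j, q j * Real.log (q j) := by
  have h : ∀ i j, P i j * Real.log (p i * q j)
      = P i j * Real.log (p i) + P i j * Real.log (q j) := fun i j => by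
    rw [Real.log_mul (hp.1 i).ne' (hq.1 j).ne', mul_add]
  simp_rw [h, Finset.sum_add_distrib]
  congr 1
  · simp_rw [← Finset.sum_mul, hP.2.1]
  · rw [Finset.sum_comm]
    simp_rw [← Finset.sum_mul, hP.2.2]

theorem aux_prod {n : ℕ} (p q : Fin n → ℝ) (hp : IsSimplex p) (hq : IsSimplex q) :
    IsPlan p q (fun i j => p i * q j) := by
  refine ⟨fun i j => (mul_pos (hp.1 i) (hq.1 j)).le, fun i => ?_, fun j => ?_⟩
  · rw [← Finset.mul_sum, hq.2, mul_one]
  · rw [← Finset.sum_mul, hp.2, one_mul]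

theorem aux_le {n : ℕ} (p : Fin n → ℝ) (hp : ∀ i, 0 ≤ p i) (i : Fin n) : p i ≤ ∑ i, p i :=
  Finset.single_le_sum (f := p) (fun i _ => hp i) (Finset.mem_univ i)

theorem aux_kl {n : ℕ} (p q : Fin n → ℝ) (hp : IsSimplex p) (hq : IsSimplex q)
    (P : Matrix (Fin n) (Fin n) ℝ) (hP : IsPlan p q P) (i j : Fin n) :
    (P i j - p i * q j) ^ 2 / 4 ≤ entM (fun i j => p i * q j) - entM P := by
  have hp1 : ∀ i, p i ≤ 1 := fun i => hp.2 ▸ aux_le p (fun i => (hp.1 i).le) i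
  have hq1 : ∀ i, q i ≤ 1 := fun i => hq.2 ▸ aux_le q (fun i => (hq.1 i).le) i
  have hP1 : ∀ i j, P i j ≤ 1 := fun i j =>
    (aux_le (P i) (hP.1 i) j).trans ((hP.2.1 i).le.trans (hp1 i))
  have hpt : ∀ i j, (P i j - p i * q j) ^ 2 / 4 ≤ P i j * Real.log (P i j)
      - P i j * Real.log (p i * q j) - P i j + p i * q j := fun i j =>
    aux_pt _ _ (hP.1 i j) (hP1 i j) (mul_pos (hp.1 i) (hq.1 j))
      (mul_le_one₀ (hp1 i) (hq.1 j).le (hq1 j))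
  have e1 := aux_log p q hp hq P hP
  have e2 := aux_log p q hp hq _ (aux_prod p q hp hq)
  have s1 : ∑ i, ∑ j, P i j = 1 := by simp_rw [hP.2.1]; exact hp.2
  have s2 : ∑ i, ∑ j, p i * q j = 1 := by
    simp_rw [(aux_prod p q hp hq).2.1]; exact hp.2
  have hs : ∑ i, ∑ j, (P i j - p i * q j) ^ 2 / 4 ≤ ∑ i, ∑ j, (P i j * Real.log (P i j)
      - P i j * Real.log (p i * q j) - P i j + p i * q j) :=
    Finset.sum_le_sum fun i _ => Finset.sum_le_sum fun j _ => hpt i j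
  simp_rw [Finset.sum_add_distrib, Finset.sum_sub_distrib] at hs
  have h1 := aux_le (fun j => (P i j - p i * q j) ^ 2 / 4) (fun j => by positivity) j
  have h2 := aux_le (fun i => ∑ j, (P i j - p i * q j) ^ 2 / 4) (fun i => by positivity) i
  unfold entM
  simp only at h1 h2 e2 ⊢
  linarith

/-- as `λ → ∞`, the entropy-relaxed optimal plan `P*_λ(p,q)` converges
entrywise to the product plan `p ⊗ q`. -/
theorem stmt10 {n : ℕ} (hn : 2 ≤ n)
    (M : Matrix (Fin n) (Fin n) ℝ) (hM : ∀ i j, 0 ≤ M i j)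
    (p q : Fin n → ℝ) (hp : IsSimplex p) (hq : IsSimplex q)
    (Pstar : ℝ → Matrix (Fin n) (Fin n) ℝ)
    (hPstar : ∀ lam : ℝ, 0 < lam → IsPlan p q (Pstar lam) ∧
      ∀ Q : Matrix (Fin n) (Fin n) ℝ, IsPlan p q Q →
        Lfun lam M (Pstar lam) ≤ Lfun lam M Q) :
    ∀ i j, Filter.Tendsto (fun lam => Pstar lam i j) Filter.atTop (nhds (p i * q j)) := by
  intro i j
  set R : Matrix (Fin n) (Fin n) ℝ := fun i j => p i * q j with hR
  have hb : ∀ lam : ℝ, 0 < lam → |Pstar lam i j - p i * q j| ≤ √(4 * cost M R / lam) := by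
    intro lam hl
    obtain ⟨hP, hmin⟩ := hPstar lam hl
    have h1 := hmin R (aux_prod p q hp hq)
    have h2 := aux_kl p q hp hq _ hP i j
    have hc : 0 ≤ cost M (Pstar lam) :=
      Finset.sum_nonneg fun i _ => Finset.sum_nonneg fun j _ => mul_nonneg (hM i j) (hP.1 i j)
    have h3 : cost M (Pstar lam) - lam * entM (Pstar lam) ≤ cost M R - lam * entM R := by
      have h4 : (0 : ℝ) < 1 + lam := by linarith
      have h5 : ∀ P, Lfun lam M P = (cost M P - lam * entM P) / (1 + lam) := fun P => by
        unfold Lfun; ring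
      rw [h5, h5] at h1
      exact (div_le_div_iff_of_pos_right h4).1 h1
    apply Real.abs_le_sqrt
    rw [le_div_iff₀ hl]
    have h6 := mul_le_mul_of_nonneg_left h2 hl.le
    rw [← hR] at h6
    linarith
  have hlim : Filter.Tendsto (fun lam : ℝ => √(4 * cost M R / lam)) Filter.atTop (nhds 0) := by
    have h := (Filter.Tendsto.const_div_atTop (Filter.tendsto_id (α := ℝ)) (4 * cost M R)).sqrt
    simpa using h
  rw [tendsto_iff_norm_sub_tendsto_zero]
  refine squeeze_zero' (Filter.Eventually.of_forall fun _ => norm_nonneg _) ?_ hlim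
  filter_upwards [Filter.eventually_gt_atTop 0] with lam hl
  exact hb lam hl
end

section
/- (Example 1, λ → 0 limit for n = 2) Let n = 2 with cost matrix m_11 = m_22 = 0, m_12 = m_21 = 1, and let p = (p, 1-p), q = (q, 1-q) with 0 < p < 1, 0 < q < 1. For λ > 0 let P*_λ(p,p) and P*_λ(p,q) be the unique minimizers of L_λ over U(p,p) and U(p,q). Then lim_{λ → 0} KL[P*_λ(p,p) : P*_λ(p,q)] = p log(p/q) if p ≥ q, and = (1-p) log((1-p)/(1-q)) if p < q. -/
open Finset Real

theorem gibbs_le (u v : ℝ) (hu : 0 ≤ u) (hv : 0 < v) :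
    u - v ≤ u * Real.log u - u * Real.log v := by
  rcases hu.eq_or_lt with h | h
  · subst h; simp; exact hv.le
  · have h1 := Real.log_le_sub_one_of_pos (div_pos hv h)
    rw [Real.log_div hv.ne' h.ne'] at h1
    have h2 := mul_le_mul_of_nonneg_left h1 h.le
    have h3 : u * (v / u - 1) = v - u := by field_simp
    rw [h3] at h2
    linarith

theorem gibbs_lt (u v : ℝ) (hu : 0 ≤ u) (hv : 0 < v) (huv : u ≠ v) :
    u - v < u * Real.log u - u * Real.log v := by
  rcases hu.eq_or_lt with h | h
  · subst h; simp; exact hv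
  · have h1 := Real.log_lt_sub_one_of_pos (div_pos hv h) (by
      intro h4
      rw [div_eq_one_iff_eq h.ne'] at h4
      exact huv h4.symm)
    rw [Real.log_div hv.ne' h.ne'] at h1
    have h2 := mul_lt_mul_of_pos_left h1 h
    have h3 : u * (v / u - 1) = v - u := by field_simp
    rw [h3] at h2
    linarith

theorem exists_root (p q E : ℝ) (hp : 0 < p ∧ p < 1) (hq : 0 < q ∧ q < 1) (hE : 0 < E) :
    ∃ a : ℝ, 0 < a ∧ 0 < p - a ∧ 0 < q - a ∧ 0 < 1 - p - q + a ∧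
      a * (1 - p - q + a) = E * ((p - a) * (q - a)) := by
  obtain ⟨hp0, hp1⟩ := hp
  obtain ⟨hq0, hq1⟩ := hq
  have hlt : max 0 (p + q - 1) < min p q := by
    simp only [max_lt_iff, lt_min_iff]
    refine ⟨⟨?_, ?_⟩, ?_, ?_⟩ <;> linarith
  set g : ℝ → ℝ := fun x => x * (1 - p - q + x) - E * ((p - x) * (q - x)) with hg
  have hc : ContinuousOn g (Set.Icc (max 0 (p + q - 1)) (min p q)) := by
    apply Continuous.continuousOn
    rw [hg]; fun_prop
  have hl : g (max 0 (p + q - 1)) < 0 := by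
    rcases max_choice 0 (p + q - 1) with h | h <;> rw [h] <;> simp only [hg]
    · have := mul_pos hE (mul_pos hp0 hq0)
      simp; exact this
    · have := mul_pos hE (mul_pos (sub_pos.2 hq1) (sub_pos.2 hp1))
      nlinarith
  have hr : 0 < g (min p q) := by
    rcases min_choice p q with h | h <;> rw [h] <;> simp only [hg]
    · have := mul_pos hp0 (sub_pos.2 hq1)
      nlinarith
    · have := mul_pos hq0 (sub_pos.2 hp1)
      nlinarith
  obtain ⟨a, ⟨ha1, ha2⟩, ha⟩ := intermediate_value_Ioo hlt.le hc ⟨hl, hr⟩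
  rw [max_lt_iff] at ha1
  rw [lt_min_iff] at ha2
  refine ⟨a, ha1.1, by linarith [ha2.1], by linarith [ha2.2], by linarith [ha1.2], ?_⟩
  simp only [hg] at ha
  linarith

theorem key (p q lam : ℝ) (hp : 0 < p ∧ p < 1) (hq : 0 < q ∧ q < 1) (hl : 0 < lam)
    (P : Matrix (Fin 2) (Fin 2) ℝ)
    (hP : IsPlan ![p, 1 - p] ![q, 1 - q] P)
    (hm : ∀ Q : Matrix (Fin 2) (Fin 2) ℝ, IsPlan ![p, 1 - p] ![q, 1 - q] Q →
        Lfun lam !![0, 1; 1, 0] P ≤ Lfun lam !![0, 1; 1, 0] Q) :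
    0 < P 0 0 ∧ 0 < p - P 0 0 ∧ 0 < q - P 0 0 ∧ 0 < 1 - p - q + P 0 0 ∧
      P 0 1 = p - P 0 0 ∧ P 1 0 = q - P 0 0 ∧ P 1 1 = 1 - p - q + P 0 0 ∧
      P 0 0 * (1 - p - q + P 0 0) = Real.exp (2 / lam) * ((p - P 0 0) * (q - P 0 0)) := by
  obtain ⟨a, ha, hb, hc, hd, hE⟩ := exists_root p q (Real.exp (2 / lam)) hp hq (Real.exp_pos _)
  obtain ⟨hnn, hr, hcol⟩ := hP
  have r0 := hr 0
  have r1 := hr 1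
  have c0 := hcol 0
  simp [Fin.sum_univ_two] at r0 r1 c0
  have n00 := hnn 0 0
  have n01 := hnn 0 1
  have n10 := hnn 1 0
  have n11 := hnn 1 1
  have e01 : P 0 1 = p - P 0 0 := by linarith
  have e10 : P 1 0 = q - P 0 0 := by linarith
  have e11 : P 1 1 = 1 - p - q + P 0 0 := by linarith
  have hmain : P 0 0 = a := by
    by_contra hne
    have h := hm !![a, p - a; q - a, 1 - p - q + a] (by
      refine ⟨?_, ?_, ?_⟩
      · intro i j; fin_cases i <;> fin_cases j <;> simp <;> linarith
      · intro i; fin_cases i <;> simp [Fin.sum_univ_two]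
      · intro i; fin_cases i <;> simp [Fin.sum_univ_two]; ring)
    simp only [Lfun, cost, entM, Fin.sum_univ_two] at h
    simp at h
    rw [e01, e10, e11] at h
    rw [e01] at n01
    rw [e10] at n10
    rw [e11] at n11
    generalize P 0 0 = x at *
    have hlog : Real.log a + Real.log (1 - p - q + a)
        = 2 / lam + (Real.log (p - a) + Real.log (q - a)) := by
      rw [← Real.log_mul ha.ne' hd.ne', hE, Real.log_mul (Real.exp_pos _).ne' (by positivity),
        Real.log_exp, Real.log_mul hb.ne' hc.ne']
    have g1 := gibbs_lt x a n00 ha hne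
    have g2 := gibbs_le _ _ n01 hb
    have g3 := gibbs_le _ _ n10 hc
    have g4 := gibbs_le _ _ n11 hd
    have h1 : (0:ℝ) < 1 + lam := by linarith
    field_simp at h
    have h2 : lam * (Real.log a + Real.log (1 - p - q + a))
        = 2 + lam * (Real.log (p - a) + Real.log (q - a)) := by
      rw [hlog]; field_simp
    have g := mul_pos hl (show 0 < (x * Real.log x - x * Real.log a) +
      ((p - x) * Real.log (p - x) - (p - x) * Real.log (p - a)) +
      ((q - x) * Real.log (q - x) - (q - x) * Real.log (q - a)) +
      ((1 - p - q + x) * Real.log (1 - p - q + x)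
        - (1 - p - q + x) * Real.log (1 - p - q + a)) by linarith)
    have h3 := congrArg (fun z => (x - a) * z) h2
    nlinarith
  rw [hmain] at e01 e10 e11 ⊢
  exact ⟨ha, hb, hc, hd, e01, e10, e11, hE⟩

/-- quantitative closeness -/
theorem close (p q lam a : ℝ) (hp : 0 < p ∧ p < 1) (hq : 0 < q ∧ q < 1)
    (ha : 0 < a) (hb : 0 < p - a) (hc : 0 < q - a) (hd : 0 < 1 - p - q + a)
    (hE : a * (1 - p - q + a) = Real.exp (2 / lam) * ((p - a) * (q - a))) :
    min p q - Real.exp (-lam⁻¹) ≤ a := by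
  have h1 : (p - a) * (q - a) = a * (1 - p - q + a) * Real.exp (-lam⁻¹) ^ 2 := by
    rw [hE, ← Real.exp_nat_mul, mul_right_comm, ← Real.exp_add]
    have : 2 / lam + ((2:ℕ):ℝ) * -lam⁻¹ = 0 := by push_cast; ring
    rw [this]; simp
  have he := Real.exp_pos (-lam⁻¹)
  have h2 : a * (1 - p - q + a) ≤ 1 := by
    apply mul_le_one₀ <;> linarith [hp.2, hq.2]
  have h3 : (p - a) * (q - a) ≤ Real.exp (-lam⁻¹) ^ 2 := by
    rw [h1]; exact mul_le_of_le_one_left (by positivity) h2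
  by_contra hcon
  push Not at hcon
  have k1 := min_le_left p q
  have k2 := min_le_right p q
  nlinarith [mul_lt_mul'' (show Real.exp (-lam⁻¹) < p - a by linarith)
    (show Real.exp (-lam⁻¹) < q - a by linarith) he.le he.le]

theorem exp_lim : Filter.Tendsto (fun lam : ℝ => Real.exp (-lam⁻¹))
    (nhdsWithin 0 (Set.Ioi 0)) (nhds 0) := 
  Real.tendsto_exp_neg_atTop_nhds_zero.comp tendsto_inv_nhdsGT_zero

theorem exp_lim1 : Filter.Tendsto (fun lam : ℝ => Real.exp (-lam⁻¹) * (2 / lam))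
    (nhdsWithin 0 (Set.Ioi 0)) (nhds 0) := by
  have := ((Real.tendsto_pow_mul_exp_neg_atTop_nhds_zero 1).comp
    (tendsto_inv_nhdsGT_zero (𝕜 := ℝ))).const_mul 2
  simp only [mul_zero] at this
  refine this.congr (fun x => ?_)
  simp only [Function.comp, pow_one]
  ring

theorem lim_a (p q : ℝ) (hp : 0 < p ∧ p < 1) (hq : 0 < q ∧ q < 1)
    (P : ℝ → Matrix (Fin 2) (Fin 2) ℝ)
    (hP : ∀ lam : ℝ, 0 < lam → IsPlan ![p, 1 - p] ![q, 1 - q] (P lam) ∧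
      ∀ Q : Matrix (Fin 2) (Fin 2) ℝ, IsPlan ![p, 1 - p] ![q, 1 - q] Q →
        Lfun lam !![0, 1; 1, 0] (P lam) ≤ Lfun lam !![0, 1; 1, 0] Q) :
    Filter.Tendsto (fun lam => P lam 0 0) (nhdsWithin 0 (Set.Ioi 0)) (nhds (min p q)) := by
  have h0 := exp_lim.const_sub (min p q)
  rw [sub_zero] at h0
  refine tendsto_of_tendsto_of_tendsto_of_le_of_le' h0 tendsto_const_nhds ?_ ?_ <;>
    filter_upwards [self_mem_nhdsWithin] with lam hl <;>
    obtain ⟨h1, h2, h3, h4, -, -, -, h5⟩ := key p q lam hp hq hl _ (hP lam hl).1 (hP lam hl).2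
  · exact close p q lam _ hp hq h1 h2 h3 h4 h5
  · exact le_min (by linarith) (by linarith)

/-- Example 1, λ → 0 limit for n = 2: with cost `!![0,1;1,0]`,
`lim_{λ → 0⁺} KL[P*_λ(p,p) : P*_λ(p,q)] = p log(p/q)` if `p ≥ q`, and
`= (1-p) log((1-p)/(1-q))` if `p < q`. -/
theorem stmt13 (p q : ℝ) (hp : 0 < p ∧ p < 1) (hq : 0 < q ∧ q < 1)
    (Ppp Ppq : ℝ → Matrix (Fin 2) (Fin 2) ℝ)
    (hPpp : ∀ lam : ℝ, 0 < lam → IsPlan ![p, 1 - p] ![p, 1 - p] (Ppp lam) ∧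
      ∀ Q : Matrix (Fin 2) (Fin 2) ℝ, IsPlan ![p, 1 - p] ![p, 1 - p] Q →
        Lfun lam !![0, 1; 1, 0] (Ppp lam) ≤ Lfun lam !![0, 1; 1, 0] Q)
    (hPpq : ∀ lam : ℝ, 0 < lam → IsPlan ![p, 1 - p] ![q, 1 - q] (Ppq lam) ∧
      ∀ Q : Matrix (Fin 2) (Fin 2) ℝ, IsPlan ![p, 1 - p] ![q, 1 - q] Q →
        Lfun lam !![0, 1; 1, 0] (Ppq lam) ≤ Lfun lam !![0, 1; 1, 0] Q) :
    Filter.Tendsto (fun lam => klM (Ppp lam) (Ppq lam))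
      (nhdsWithin 0 (Set.Ioi 0))
      (nhds (if q ≤ p then p * Real.log (p / q)
        else (1 - p) * Real.log ((1 - p) / (1 - q)))) := by
  have A := lim_a p q hp hq Ppq hPpq
  have X := lim_a p p hp hp Ppp hPpp
  rw [min_self] at X
  have hm : 0 < min p q := lt_min hp.1 hq.1
  have hd : 0 < 1 - p - q + min p q := by
    rcases min_choice p q with h | h <;> rw [h] <;> linarith [hp.2, hq.2]
  have D := A.const_add (1 - p - q)
  have Y := X.const_add (1 - p - p)
  have T := X.const_sub p
  rw [sub_self] at T
  have hY : 1 - p - p + p = 1 - p := by ring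
  rw [hY] at Y
  have hp1 : 0 < 1 - p := by linarith [hp.2]
  have T1 : Filter.Tendsto (fun lam => (p - Ppp lam 0 0) * (2 / lam))
      (nhdsWithin 0 (Set.Ioi 0)) (nhds 0) := by
    refine tendsto_of_tendsto_of_tendsto_of_le_of_le' tendsto_const_nhds exp_lim1 ?_ ?_ <;>
      filter_upwards [self_mem_nhdsWithin] with lam hl <;>
      obtain ⟨h1, h2, h3, h4, -, -, -, h5⟩ :=
        key p p lam hp hp hl _ (hPpp lam hl).1 (hPpp lam hl).2
    · have : (0:ℝ) < lam := hl
      positivity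
    · have : (0:ℝ) < lam := hl
      have h6 := close p p lam _ hp hp h1 h2 h3 h4 h5
      rw [min_self] at h6
      exact mul_le_mul_of_nonneg_right (by linarith) (by positivity)
  have T2 : Filter.Tendsto (fun lam => (p - Ppp lam 0 0) * Real.log (p - Ppp lam 0 0))
      (nhdsWithin 0 (Set.Ioi 0)) (nhds 0) := by
    have := (Real.continuous_mul_log.tendsto 0).comp T
    simpa [Function.comp_def] using this
  have F := ((((X.mul ((X.div A hm.ne').log (div_pos hp.1 hm).ne')).add
    (Y.mul ((Y.div D hd.ne').log (div_pos hp1 hd).ne'))).add (T2.const_mul 2)).sub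
    (T.mul ((A.log hm.ne').add (D.log hd.ne')))).add T1
  have hval : p * Real.log (p / min p q) + (1 - p) * Real.log ((1 - p) / (1 - p - q + min p q))
      + 2 * 0 - 0 * (Real.log (min p q) + Real.log (1 - p - q + min p q)) + 0
      = (if q ≤ p then p * Real.log (p / q)
        else (1 - p) * Real.log ((1 - p) / (1 - q))) := by
    split_ifs with h
    · rw [min_eq_right h]
      have : 1 - p - q + q = 1 - p := by ring
      rw [this, div_self hp1.ne']; simp
    · rw [min_eq_left (not_le.1 h).le]
      have : 1 - p - q + p = 1 - q := by ring
      rw [this, div_self hp.1.ne']; simp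
  rw [hval] at F
  refine F.congr' ?_
  filter_upwards [self_mem_nhdsWithin] with lam hl
  have hl' : (0:ℝ) < lam := hl
  obtain ⟨x1, x2, x3, x4, x5, x6, x7, x8⟩ :=
    key p p lam hp hp hl _ (hPpp lam hl).1 (hPpp lam hl).2
  obtain ⟨a1, a2, a3, a4, a5, a6, a7, a8⟩ :=
    key p q lam hp hq hl _ (hPpq lam hl).1 (hPpq lam hl).2
  simp only [klM, Fin.sum_univ_two, Pi.div_apply]
  rw [x5, x6, x7, a5, a6, a7]
  generalize Ppp lam 0 0 = x at *
  generalize Ppq lam 0 0 = a at *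
  have hlog : Real.log a + Real.log (1 - p - q + a)
        = 2 / lam + (Real.log (p - a) + Real.log (q - a)) := by
    rw [← Real.log_mul a1.ne' a4.ne', a8, Real.log_mul (Real.exp_pos _).ne' (by positivity),
      Real.log_exp, Real.log_mul a2.ne' a3.ne']
  rw [hlog, Real.log_div x2.ne' a2.ne', Real.log_div x2.ne' a3.ne']
  ring
end

section
/- (Monotonicity of the Sinkhorn step) Let P ∈ ℝ^{n×n} be entrywise strictly positive with Σ_{ij} P_ij = 1, let p ∈ S_{n-1}, and define (T_A P)_ij = (p_i / Σ_k P_ik) P_ij. Let P* be any entrywise-nonnegative matrix summing to 1 with row sums Σ_j P*_ij = p_i for all i. Then KL[P* : T_A P] ≤ KL[P* : P], with equality if and only if P already has row sums Σ_j P_ij = p_i for all i. -/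
open Finset Real

/-- Monotonicity of the Sinkhorn step:
`KL[P* : T_A P] ≤ KL[P* : P]`, with equality iff `P` already has row sums `p`. -/
theorem stmt19 {n : ℕ} (hn : 2 ≤ n)
    (P : Matrix (Fin n) (Fin n) ℝ) (hPpos : ∀ i j, 0 < P i j)
    (hPsum : ∑ i, ∑ j, P i j = 1)
    (p : Fin n → ℝ) (hp : IsSimplex p)
    (TP : Matrix (Fin n) (Fin n) ℝ)
    (hTP : ∀ i j, TP i j = (p i / ∑ k, P i k) * P i j)
    (Pstar : Matrix (Fin n) (Fin n) ℝ)
    (hstar_nonneg : ∀ i j, 0 ≤ Pstar i j)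
    (hstar_sum : ∑ i, ∑ j, Pstar i j = 1)
    (hstar_rows : ∀ i, ∑ j, Pstar i j = p i) :
    klM Pstar TP ≤ klM Pstar P ∧
      (klM Pstar TP = klM Pstar P ↔ ∀ i, ∑ j, P i j = p i) := by
  obtain ⟨hp0, hp1⟩ := hp
  have hr : ∀ i, 0 < ∑ k, P i k := fun i =>
    Finset.sum_pos (fun k _ => hPpos i k) ⟨i, Finset.mem_univ i⟩
  have key : klM Pstar P - klM Pstar TP
      = ∑ i, (p i * Real.log (p i / ∑ k, P i k) - p i + ∑ k, P i k) := by
    have h1 : klM Pstar P - klM Pstar TP = ∑ i, p i * Real.log (p i / ∑ k, P i k) := by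
      unfold klM
      rw [← Finset.sum_sub_distrib]
      refine Finset.sum_congr rfl fun i _ => ?_
      rw [← Finset.sum_sub_distrib]
      conv_rhs => rw [← hstar_rows i, Finset.sum_mul, hstar_rows i]
      refine Finset.sum_congr rfl fun j _ => ?_
      rcases (hstar_nonneg i j).eq_or_lt with h | h
      · simp [← h]
      · have hc : 0 < p i / ∑ k, P i k := div_pos (hp0 i) (hr i)
        rw [hTP, Real.log_div h.ne' (hPpos i j).ne',
          Real.log_div h.ne' (mul_pos hc (hPpos i j)).ne',
          Real.log_mul hc.ne' (hPpos i j).ne']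
        ring
    rw [h1, Finset.sum_add_distrib, Finset.sum_sub_distrib, hp1, hPsum]
    ring
  have hlog : ∀ i, Real.log (p i / ∑ k, P i k) = - Real.log ((∑ k, P i k) / p i) := fun i => by
    rw [← Real.log_inv, inv_div]
  have hmul : ∀ i, p i * ((∑ k, P i k) / p i) = ∑ k, P i k := fun i =>
    mul_div_cancel₀ _ (hp0 i).ne'
  have hnn : ∀ i, 0 ≤ p i * Real.log (p i / ∑ k, P i k) - p i + ∑ k, P i k := fun i => by
    have h := mul_le_mul_of_nonneg_left
      (Real.log_le_sub_one_of_pos (div_pos (hr i) (hp0 i))) (hp0 i).le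
    rw [mul_sub, hmul] at h
    rw [hlog]
    linarith
  refine ⟨?_, ?_, ?_⟩
  · have := Finset.sum_nonneg (fun i (_ : i ∈ Finset.univ) => hnn i)
    linarith
  · intro heq i
    rw [heq, sub_self] at key
    have h0 := (Finset.sum_eq_zero_iff_of_nonneg (fun i _ => hnn i)).1 key.symm i
      (Finset.mem_univ i)
    by_contra hne
    have hne1 : (∑ k, P i k) / p i ≠ 1 := fun h => hne ((div_eq_one_iff_eq (hp0 i).ne').1 h)
    have h := mul_lt_mul_of_pos_left
      (Real.log_lt_sub_one_of_pos (div_pos (hr i) (hp0 i)) hne1) (hp0 i)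
    rw [mul_sub, hmul] at h
    rw [hlog] at h0
    linarith
  · intro h
    have : TP = P := by
      ext i j
      rw [hTP, h, div_self (hp0 i).ne', one_mul]
    rw [this]
end
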